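/- arXiv:1011.6659 — 7 statements merged into one kernel-verified Lean document; each statement's English description precedes it below -/
import Mathlib

section
/- Let ℓ ≥ 1 and let μ₁, μ₂ be weights with 0 ≤ μ₁, μ₂ ≤ ℓ. Then deg_ℓ(μ₁,μ₂,1,1) = 1 if (μ₁,μ₂) = (ℓ,ℓ), and deg_ℓ(μ₁,μ₂,1,1) = 0 otherwise. -/
open Finset

/-- Three-point fusion rank for sl₂ at level ℓ. -/
def N₃ (ℓ a b c : ℕ) : ℕ :=
  if (a + b + c) % 2 = 0 ∧ a + b + c ≤ 2 * ℓ ∧ a ≤ (a + b + c) / 2 ∧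
      b ≤ (a + b + c) / 2 ∧ c ≤ (a + b + c) / 2 then 1 else 0

/-- Auxiliary rank function on the reversed list of weights: the recursion removes the
first two entries (the last two weights) and inserts μ. -/
def Nrev (ℓ : ℕ) : List ℕ → ℕ
  | [] => 1
  | [a] => if a = 0 then 1 else 0
  | [a, b] => if a = b then 1 else 0
  | [a, b, c] => N₃ ℓ c b a
  | a :: b :: c :: d :: rest =>
      ∑ μ ∈ Finset.range (ℓ + 1), Nrev ℓ (μ :: c :: d :: rest) * N₃ ℓ b a μ
  termination_by l => l.length

/-- The sl₂ rank N(λ₁,…,λₙ) of the conformal blocks bundle V(sl₂,ℓ,λ⃗). -/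
def N (ℓ : ℕ) (l : List ℕ) : ℕ := Nrev ℓ l.reverse

/-- Casimir scalar c(α) = α²/2 + α. -/
def cas (α : ℕ) : ℚ := (α : ℚ) ^ 2 / 2 + α

/-- Fakhruddin's degree of V(sl₂,ℓ,(μ₁,μ₂,μ₃,μ₄)) on M̄₀,₄. -/
def degF (ℓ μ₁ μ₂ μ₃ μ₄ : ℕ) : ℚ :=
  (1 / (2 * ((ℓ : ℚ) + 2))) *
    ((N ℓ [μ₁, μ₂, μ₃, μ₄] : ℚ) * (cas μ₁ + cas μ₂ + cas μ₃ + cas μ₄)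
      - ∑ α ∈ Finset.range (ℓ + 1), cas α *
          ((N₃ ℓ μ₁ μ₂ α * N₃ ℓ μ₃ μ₄ α + N₃ ℓ μ₁ μ₃ α * N₃ ℓ μ₂ μ₄ α
            + N₃ ℓ μ₁ μ₄ α * N₃ ℓ μ₂ μ₃ α : ℕ) : ℚ))

/-- r_ℓ(j,t): determined by r_ℓ(j,t)=0 for t<0 or t>ℓ, r_ℓ(0,0)=1, r_ℓ(0,t)=0 otherwise,
and r_ℓ(j,t) = r_ℓ(j−1,t−1) + r_ℓ(j−1,t+1) for j ≥ 1, 0 ≤ t ≤ ℓ. -/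
def rL (ℓ : ℕ) : ℕ → ℤ → ℕ
  | 0, t => if t = 0 then 1 else 0
  | j + 1, t =>
      if t < 0 ∨ (ℓ : ℤ) < t then 0 else rL ℓ j (t - 1) + rL ℓ j (t + 1)

/-- r_∞(j,t): determined by r_∞(j,t)=0 for t<0 or t>j, r_∞(0,0)=1,
and r_∞(j,t) = r_∞(j−1,t−1) + r_∞(j−1,t+1) for j ≥ 1, 0 ≤ t ≤ j. -/
def rInf : ℕ → ℤ → ℕ
  | 0, t => if t = 0 then 1 else 0
  | j + 1, t =>
      if t < 0 ∨ ((j : ℤ) + 1) < t then 0 else rInf j (t - 1) + rInf j (t + 1)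

/-- Fakhruddin's intersection number of D^{sl₂}_{ℓ,(1,…,1)} with the F-curve
F_{j₁,j₂,j₃,j₄}. -/
def IF (ℓ j₁ j₂ j₃ j₄ : ℕ) : ℚ :=
  ∑ μ₁ ∈ Finset.range (ℓ + 1), ∑ μ₂ ∈ Finset.range (ℓ + 1),
    ∑ μ₃ ∈ Finset.range (ℓ + 1), ∑ μ₄ ∈ Finset.range (ℓ + 1),
      degF ℓ μ₁ μ₂ μ₃ μ₄ * (rL ℓ j₁ (μ₁ : ℤ) : ℚ) * (rL ℓ j₂ (μ₂ : ℤ) : ℚ)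
        * (rL ℓ j₃ (μ₃ : ℤ) : ℚ) * (rL ℓ j₄ (μ₄ : ℤ) : ℚ)

/-- Binomial coefficient C(n,m) with integer lower argument, with the convention
C(n,m) = 0 for m < 0. -/
def chooseZ (n : ℕ) (m : ℤ) : ℕ := if m < 0 then 0 else n.choose m.toNat

theorem N₃_one_right {ℓ a : ℕ} (ha : a ≤ ℓ) (α : ℕ) :
    N₃ ℓ a 1 α = (if α = a + 1 ∧ a + 1 ≤ ℓ then 1 else 0) + (if α + 1 = a then 1 else 0) := by
  unfold N₃
  split_ifs <;> omega

/-- Summing against the fusion rule with weight `1` picks out the two neighbours of `a`. -/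
theorem sum_mul_N₃_one_right {ℓ a : ℕ} (ha : a ≤ ℓ) (f : ℕ → ℚ) :
    ∑ α ∈ Finset.range (ℓ + 1), f α * (N₃ ℓ a 1 α : ℚ)
      = (if a + 1 ≤ ℓ then f (a + 1) else 0) + (if 1 ≤ a then f (a - 1) else 0) := by
  have h : ∀ α ∈ Finset.range (ℓ + 1), f α * (N₃ ℓ a 1 α : ℚ) =
      (if α = a + 1 then f α else 0) + (if α = a - 1 then if 1 ≤ a then f α else 0 else 0) := by
    intro α hα
    rw [Finset.mem_range] at hα
    rw [N₃_one_right ha]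
    split_ifs <;> first | omega | simp
  rw [Finset.sum_congr rfl h, Finset.sum_add_distrib, Finset.sum_ite_eq', Finset.sum_ite_eq']
  simp only [Finset.mem_range]
  congr 1 <;> split_ifs <;> first | omega | rfl

theorem N_four (ℓ a b c d : ℕ) :
    N ℓ [a, b, c, d] = ∑ μ ∈ Finset.range (ℓ + 1), N₃ ℓ a b μ * N₃ ℓ c d μ := by
  simp [N, Nrev]

theorem degF_one_one {ℓ b : ℕ} (a : ℕ) (hℓ : 1 ≤ ℓ) (hb : b ≤ ℓ) :
    degF ℓ a b 1 1 = (1 / (2 * ((ℓ : ℚ) + 2))) *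
      (((if 2 ≤ ℓ then (N₃ ℓ a b 2 : ℚ) else 0) + N₃ ℓ a b 0) * (cas a + cas b + 3)
        - (if 2 ≤ ℓ then 4 * (N₃ ℓ a b 2 : ℚ) else 0)
        - 2 * ((if b + 1 ≤ ℓ then cas (b + 1) * N₃ ℓ a 1 (b + 1) else 0)
          + (if 1 ≤ b then cas (b - 1) * N₃ ℓ a 1 (b - 1) else 0))) := by
  have hN := sum_mul_N₃_one_right hℓ (fun α => (N₃ ℓ a b α : ℚ))
  have h₁ := sum_mul_N₃_one_right hℓ (fun α => cas α * (N₃ ℓ a b α : ℚ))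
  have h₂ := sum_mul_N₃_one_right hb (fun α => cas α * (N₃ ℓ a 1 α : ℚ))
  have hsplit : ∑ α ∈ Finset.range (ℓ + 1), cas α *
      ((N₃ ℓ a b α * N₃ ℓ 1 1 α + N₃ ℓ a 1 α * N₃ ℓ b 1 α
        + N₃ ℓ a 1 α * N₃ ℓ b 1 α : ℕ) : ℚ) =
      ∑ α ∈ Finset.range (ℓ + 1), cas α * (N₃ ℓ a b α : ℚ) * (N₃ ℓ 1 1 α : ℚ)
      + 2 * ∑ α ∈ Finset.range (ℓ + 1), cas α * (N₃ ℓ a 1 α : ℚ) * (N₃ ℓ b 1 α : ℚ) := by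
    rw [Finset.mul_sum, ← Finset.sum_add_distrib]
    refine Finset.sum_congr rfl fun α _ => ?_
    push_cast
    ring
  have c0 : cas 0 = 0 := by norm_num [cas]
  have c1 : cas 1 = 3 / 2 := by norm_num [cas]
  have c2 : cas 2 = 4 := by norm_num [cas]
  simp only [le_refl, if_true, Nat.reduceAdd, Nat.sub_self, c0, c2, zero_mul, add_zero]
    at hN h₁
  unfold degF
  rw [hsplit, h₁, h₂, N_four]
  push_cast
  rw [hN, c1]
  ring

theorem N₃_zero_right {ℓ a : ℕ} (ha : a ≤ ℓ) (b : ℕ) :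
    N₃ ℓ a b 0 = if a = b then 1 else 0 := by
  unfold N₃
  split_ifs <;> omega

theorem N₃_two_right {ℓ a b : ℕ} (ha : a ≤ ℓ) (hb : b ≤ ℓ) :
    N₃ ℓ a b 2 = if b = a + 2 ∨ a = b + 2 ∨ (a = b ∧ 1 ≤ a ∧ a < ℓ) then 1 else 0 := by
  unfold N₃
  split_ifs <;> omega

/-- Fakhruddin's degree of V(sl₂,ℓ,(μ₁,μ₂,1,1)) on M̄₀,₄: it is 1 if (μ₁,μ₂) = (ℓ,ℓ)
and 0 otherwise. -/
theorem deg_mu_mu_one_one (ℓ μ₁ μ₂ : ℕ) (hℓ : 1 ≤ ℓ) (h1 : μ₁ ≤ ℓ) (h2 : μ₂ ≤ ℓ) :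
    degF ℓ μ₁ μ₂ 1 1 = if μ₁ = ℓ ∧ μ₂ = ℓ then 1 else 0 := by
  rw [degF_one_one μ₁ hℓ h2, N₃_zero_right h1, N₃_two_right h1 h2, N₃_one_right h1,
    N₃_one_right h1]
  have hℓ' : (ℓ : ℚ) + 2 ≠ 0 := by positivity
  rcases eq_or_ne μ₁ μ₂ with rfl | hne
  · rcases Nat.eq_zero_or_pos μ₁ with rfl | hpos
    · have h0 : ¬ 0 = ℓ := by omega
      simp [h0, hℓ, cas]
      norm_num
    · obtain ⟨m, rfl⟩ : ∃ m, μ₁ = m + 1 := ⟨μ₁ - 1, by omega⟩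
      rcases h1.eq_or_lt with rfl | hlt
      · simp [cas]
        push_cast at hℓ'
        field_simp
        ring
      · have h2ℓ : 2 ≤ ℓ := by omega
        have hlt' : m + 1 + 1 ≤ ℓ := hlt
        have e₁ : ¬ m = m + 1 + 1 := by omega
        have e₂ : ¬ m + 1 + 1 = m := by omega
        simp [hlt, hlt', h2ℓ, hlt.ne, e₁, e₂, cas]
        right
        ring
  · have hnot : ¬ (μ₁ = ℓ ∧ μ₂ = ℓ) := by omega
    rw [if_neg hnot]
    by_cases hb : μ₂ = μ₁ + 2
    · subst hb
      have h2ℓ : 2 ≤ ℓ := by omega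
      have h1ℓ : μ₁ + 1 ≤ ℓ := by omega
      have e₁ : ¬ μ₁ + 2 = μ₁ := by omega
      have e₂ : ¬ μ₁ + 2 + 1 + 1 = μ₁ := by omega
      simp [h2ℓ, h1ℓ, e₁, e₂, cas]
      right
      ring
    by_cases ha : μ₁ = μ₂ + 2
    · subst ha
      have h2ℓ : 2 ≤ ℓ := by omega
      have h1ℓ : μ₂ + 1 ≤ ℓ := by omega
      have e₁ : ¬ (μ₂ - 1 = μ₂ + 2 + 1 ∧ μ₂ + 2 + 1 ≤ ℓ) := by omega
      have e₂ : ¬ (μ₂ - 1 + 1 = μ₂ + 2) := by omega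
      simp only [if_neg e₁, if_neg e₂]
      simp [h2ℓ, h1ℓ, cas]
      right
      ring
    · have e₁ : ¬ (μ₂ + 1 = μ₁ + 1 ∧ μ₁ + 1 ≤ ℓ) := by omega
      have e₂ : ¬ (μ₂ + 1 + 1 = μ₁) := by omega
      have e₃ : 1 ≤ μ₂ → ¬ (μ₂ - 1 = μ₁ + 1 ∧ μ₁ + 1 ≤ ℓ) := by omega
      have e₄ : 1 ≤ μ₂ → ¬ (μ₂ - 1 + 1 = μ₁) := by omega
      by_cases hμ : 1 ≤ μ₂
      · simp only [if_neg e₁, if_neg e₂, if_neg (e₃ hμ), if_neg (e₄ hμ)]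
        simp [hne, ha, hb]
      · simp only [if_neg e₁, if_neg e₂, if_neg hμ]
        simp [hne, ha, hb]
end

section
/- The ranks of the bundles V(sl₂,ℓ,(1,…,1,t)) are determined by a Pascal-like recurrence: for every ℓ ≥ 1, every j ≥ 0, and every t with 0 ≤ t ≤ ℓ, the rank N(1,…,1,t) of the tuple consisting of j weights equal to 1 followed by the weight t equals r_ℓ(j,t). -/
open Finset

lemma N₃_one_left {ℓ t μ : ℕ} (ht : t ≤ ℓ) (hμ : μ ≤ ℓ) :
    N₃ ℓ 1 t μ = (if μ + 1 = t then 1 else 0) + (if μ = t + 1 then 1 else 0) := by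
  unfold N₃
  split_ifs <;> omega

lemma rL_eq_zero {ℓ : ℕ} (j : ℕ) {t : ℤ} (ht : t < 0 ∨ (ℓ : ℤ) < t) :
    rL ℓ j t = 0 := by
  cases j with
  | zero => rw [rL, if_neg (by omega)]
  | succ j => rw [rL, if_pos ht]

lemma sum_rL_mul_N₃_one {ℓ t : ℕ} (ht : t ≤ ℓ) (j : ℕ) :
    ∑ μ ∈ Finset.range (ℓ + 1), rL ℓ j (μ : ℤ) * N₃ ℓ 1 t μ = rL ℓ (j + 1) (t : ℤ) := by
  have hsum : ∑ μ ∈ Finset.range (ℓ + 1), rL ℓ j (μ : ℤ) * N₃ ℓ 1 t μ =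
      ∑ μ ∈ Finset.range (ℓ + 1), ((if μ + 1 = t then rL ℓ j (μ : ℤ) else 0) +
        (if μ = t + 1 then rL ℓ j (μ : ℤ) else 0)) := by
    refine Finset.sum_congr rfl fun μ hμ => ?_
    rw [N₃_one_left ht (Nat.lt_succ_iff.mp (Finset.mem_range.mp hμ)), mul_add, mul_ite, mul_ite,
      mul_one, mul_zero]
  rw [hsum, Finset.sum_add_distrib, rL, if_neg (by omega)]
  congr 1
  · cases t with
    | zero => rw [rL_eq_zero j (by simp)]; simp
    | succ s => simp [Finset.sum_ite_eq', show s ≤ ℓ by omega]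
  · rw [Finset.sum_ite_eq']
    split_ifs with h
    · push_cast; rfl
    · rw [Finset.mem_range] at h
      exact (rL_eq_zero j (by omega)).symm

lemma Nrev_cons_replicate_one (ℓ j : ℕ) :
    ∀ t ≤ ℓ, Nrev ℓ (t :: List.replicate j 1) = rL ℓ j (t : ℤ) := by
  induction j with
  | zero => intro t _; simp [Nrev, rL]
  | succ j ih =>
    intro t ht
    match j, ih with
    | 0, _ =>
      simp only [List.replicate, Nrev, rL]
      split_ifs <;> omega
    | 1, _ =>
      simp only [List.replicate, Nrev, rL, N₃]
      split_ifs <;> omega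
    | j + 2, ih =>
      rw [← sum_rL_mul_N₃_one ht]
      simp only [List.replicate_succ, Nrev]
      refine Finset.sum_congr rfl fun μ hμ => ?_
      rw [← ih μ (Nat.lt_succ_iff.mp (Finset.mem_range.mp hμ))]
      simp only [List.replicate_succ]

/-- The rank of V(sl₂,ℓ,(1,…,1,t)) with j weights equal to 1 equals r_ℓ(j,t). -/
theorem rank_ones_t_eq_rL (ℓ j t : ℕ) (hℓ : 1 ≤ ℓ) (ht : t ≤ ℓ) :
    N ℓ (List.replicate j 1 ++ [t]) = rL ℓ j (t : ℤ) := by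
  rw [N, List.reverse_append, List.reverse_replicate]
  exact Nrev_cons_replicate_one ℓ j t ht
end

section
/- Closed form for r_∞: let j ≥ 0 and 0 ≤ t ≤ j. (1) If j = 2x and t = 2y are both even, then (x+y+1)·r_∞(j,t) = (2y+1)·C(2x, x−y), where C denotes the binomial coefficient. (2) If j = 2x+1 and t = 2y+1 are both odd, then (x+y+2)·r_∞(j,t) = (2y+2)·C(2x+1, x−y). (3) If j and t have opposite parity, then r_∞(j,t) = 0. -/
open Finset

theorem rInf_of_neg (j : ℕ) {t : ℤ} (ht : t < 0) : rInf j t = 0 := by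
  cases j with
  | zero => simp [rInf, ht.ne]
  | succ j => simp [rInf, ht]

theorem rInf_of_lt (j : ℕ) {t : ℤ} (ht : (j : ℤ) < t) : rInf j t = 0 := by
  cases j with
  | zero => simp [rInf, (show t ≠ 0 by push_cast at ht; omega)]
  | succ j =>
    push_cast at ht
    simp [rInf, ht]

theorem rInf_succ (j : ℕ) {t : ℤ} (h0 : 0 ≤ t) (h1 : t ≤ j + 1) :
    rInf (j + 1) t = rInf j (t - 1) + rInf j (t + 1) := by
  rw [rInf, if_neg (by omega)]

theorem rInf_of_odd_add (j : ℕ) (t : ℤ) (h : (j + t) % 2 = 1) : rInf j t = 0 := by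
  induction j generalizing t with
  | zero => simp [rInf, (show t ≠ 0 by rintro rfl; simp at h)]
  | succ j ih =>
    push_cast at h
    rw [rInf, ih _ (by omega), ih _ (by omega)]
    simp

theorem rInf_self (t : ℕ) : rInf t t = 1 := by
  induction t with
  | zero => simp [rInf]
  | succ t ih =>
    rw [rInf_succ t (by omega) (by push_cast; omega), rInf_of_lt t (t := ((t + 1 : ℕ) : ℤ) + 1) (by push_cast; omega)]
    simpa using ih

/-- The reflection principle: `rInf` is a difference of adjacent binomial coefficients. -/
theorem rInf_add_choose (d t : ℕ) :
    rInf (t + 2 * d + 2) t + (t + 2 * d + 2).choose d = (t + 2 * d + 2).choose (d + 1) := by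
  induction d generalizing t with
  | zero =>
    induction t with
    | zero => simp [rInf]
    | succ t ih =>
      have hr := rInf_succ (t + 2) (t := ((t + 1 : ℕ) : ℤ)) (by omega) (by push_cast; omega)
      have hs := rInf_self (t + 2)
      push_cast at hr hs
      rw [show (t : ℤ) + 1 - 1 = t by ring, show (t : ℤ) + 1 + 1 = t + 2 by ring, hs] at hr
      simp only [mul_zero, add_zero, zero_add, Nat.choose_zero_right, Nat.choose_one_right] at ih ⊢
      rw [show t + 1 + 2 = t + 2 + 1 by ring]
      push_cast
      omega
  | succ d ihd =>
    induction t with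
    | zero =>
      have hr := rInf_succ (2 * d + 3) (t := 0) le_rfl (by positivity)
      have h := ihd 1
      rw [rInf_of_neg _ (show (0 : ℤ) - 1 < 0 by norm_num)] at hr
      have hsymm := Nat.choose_symm_of_eq_add (show 2 * d + 3 = (d + 2) + (d + 1) by ring)
      have h1 := Nat.choose_succ_succ (2 * d + 3) d
      have h2 := Nat.choose_succ_succ (2 * d + 3) (d + 1)
      rw [show 1 + 2 * d + 2 = 2 * d + 3 by ring] at h
      rw [show 0 + 2 * (d + 1) + 2 = 2 * d + 3 + 1 by ring]
      simp only [Nat.succ_eq_add_one, Nat.cast_zero, Nat.cast_one, zero_add, add_assoc,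
        Nat.reduceAdd] at hr h hsymm h1 h2 ⊢
      omega
    | succ t ih =>
      have hr := rInf_succ (t + 2 * d + 4) (t := ((t + 1 : ℕ) : ℤ)) (by omega)
        (by push_cast; omega)
      have h := ihd (t + 2)
      have h1 := Nat.choose_succ_succ (t + 2 * d + 4) d
      have h2 := Nat.choose_succ_succ (t + 2 * d + 4) (d + 1)
      rw [show t + 2 + 2 * d + 2 = t + 2 * d + 4 by ring] at h
      rw [show t + 2 * (d + 1) + 2 = t + 2 * d + 4 by ring] at ih
      rw [show t + 1 + 2 * (d + 1) + 2 = t + 2 * d + 4 + 1 by ring]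
      push_cast at hr h ⊢
      rw [show (t : ℤ) + 1 - 1 = t by ring, show (t : ℤ) + 1 + 1 = t + 2 by ring] at hr
      simp only [Nat.succ_eq_add_one, add_assoc, Nat.reduceAdd] at hr h h1 h2 ih ⊢
      omega

theorem mul_rInf_add_two_mul (t d : ℕ) :
    (t + d + 1) * rInf (t + 2 * d) t = (t + 1) * (t + 2 * d).choose d := by
  cases d with
  | zero => simp [rInf_self]
  | succ d =>
    have h := rInf_add_choose d t
    have hc := Nat.choose_succ_right_eq (t + 2 * d + 2) d
    rw [show t + 2 * d + 2 - d = t + d + 2 by omega] at hc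
    rw [show t + 2 * (d + 1) = t + 2 * d + 2 by ring]
    zify at h hc ⊢
    linear_combination (t + d + 2 : ℤ) * h + hc

/-- Closed form for r_∞(j,t) for 0 ≤ t ≤ j. -/
theorem rInf_closed_form (j t : ℕ) (ht : t ≤ j) :
    (∀ x y : ℕ, j = 2 * x → t = 2 * y →
        (x + y + 1) * rInf j (t : ℤ) = (2 * y + 1) * Nat.choose (2 * x) (x - y)) ∧
    (∀ x y : ℕ, j = 2 * x + 1 → t = 2 * y + 1 →
        (x + y + 2) * rInf j (t : ℤ) = (2 * y + 2) * Nat.choose (2 * x + 1) (x - y)) ∧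
    (j % 2 ≠ t % 2 → rInf j (t : ℤ) = 0) := by
  refine ⟨?_, ?_, fun h => rInf_of_odd_add j t (by omega)⟩
  · rintro x y rfl rfl
    obtain ⟨d, rfl⟩ := Nat.exists_eq_add_of_le (show y ≤ x by omega)
    have h := mul_rInf_add_two_mul (2 * y) d
    rw [← mul_add] at h
    rw [Nat.add_sub_cancel_left, ← h]
    ring
  · rintro x y rfl rfl
    obtain ⟨d, rfl⟩ := Nat.exists_eq_add_of_le (show y ≤ x by omega)
    have h := mul_rInf_add_two_mul (2 * y + 1) d
    rw [show 2 * y + 1 + 2 * d = 2 * (y + d) + 1 by ring] at h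
    rw [Nat.add_sub_cancel_left, ← h]
    ring
end

section
/- Closed form for r_ℓ, even case: let ℓ ≥ 1, let j = 2x ≥ 0 and t = 2y be even with 0 ≤ t ≤ ℓ, and set K = ⌈j/(2(ℓ+2))⌉. Then, as an equality of rational numbers, r_ℓ(j,t) = Σ_{k=0}^{K} ( ((2y+2k(ℓ+2)+1)/(x+y+k(ℓ+2)+1))·C(2x, x−y−k(ℓ+2)) − (((2k+2)(ℓ+2)−2y−1)/(x+(k+1)(ℓ+2)−y))·C(2x, x−(k+1)(ℓ+2)+y+1) ), where C(n,m) denotes the binomial coefficient with the convention C(n,m) = 0 for m < 0. -/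
open Finset

/-- The number of `j`-step `±1` walks on `ℤ` from `0` to `s`. -/
def walkCount : ℕ → ℤ → ℤ
  | 0, s => if s = 0 then 1 else 0
  | j + 1, s => walkCount j (s - 1) + walkCount j (s + 1)

theorem walkCount_neg (j : ℕ) (s : ℤ) : walkCount j (-s) = walkCount j s := by
  induction j generalizing s with
  | zero => simp [walkCount]
  | succ j ih =>
    have h₁ : -s - 1 = -(s + 1) := by ring
    have h₂ : -s + 1 = -(s - 1) := by ring
    simp only [walkCount]
    rw [h₁, h₂, ih, ih, add_comm]

theorem walkCount_eq_zero {j : ℕ} {s : ℤ} (h : (j : ℤ) < s) : walkCount j s = 0 := by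
  induction j generalizing s with
  | zero =>
    have : s ≠ 0 := by omega
    simp [walkCount, this]
  | succ j ih =>
    simp only [walkCount]
    rw [ih (by omega), ih (by omega), add_zero]

theorem chooseZ_succ (n : ℕ) (i : ℤ) :
    chooseZ (n + 1) i = chooseZ n i + chooseZ n (i - 1) := by
  rcases lt_trichotomy i 0 with h | rfl | h
  · simp [chooseZ, h, show i < 1 by omega]
  · simp [chooseZ]
  · obtain ⟨a, rfl⟩ : ∃ a : ℕ, i = ((a + 1 : ℕ) : ℤ) := ⟨(i - 1).toNat, by omega⟩
    have h₁ : ((a + 1 : ℕ) : ℤ) - 1 = (a : ℤ) := by push_cast; ring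
    have h₂ : ¬ ((a + 1 : ℕ) : ℤ) < 0 := by omega
    have h₃ : ¬ (a : ℤ) < 0 := by omega
    simp only [chooseZ, h₁, if_neg h₂, if_neg h₃, Int.toNat_natCast]
    rw [Nat.choose_succ_succ, add_comm]

theorem walkCount_eq_chooseZ (j : ℕ) (i : ℤ) : walkCount j (j - 2 * i) = chooseZ j i := by
  induction j generalizing i with
  | zero =>
    rcases lt_trichotomy i 0 with h | rfl | h
    · simp [walkCount, chooseZ, h, h.ne]
    · simp [walkCount, chooseZ]
    · have : 0 < i.toNat := by omega
      simp [walkCount, chooseZ, h.ne', h.not_gt, Nat.choose_eq_zero_of_lt this]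
  | succ j ih =>
    rw [chooseZ_succ]
    push_cast
    rw [← ih, ← ih]
    simp only [walkCount]
    congr 2 <;> ring

theorem chooseZ_sub_chooseZ_pred (n : ℕ) (i : ℤ) (hi : i ≤ n) :
    (chooseZ n i : ℚ) - chooseZ n (i - 1) =
      ((n : ℚ) - 2 * i + 1) / ((n : ℚ) - i + 1) * chooseZ n i := by
  have hpos : (0 : ℚ) < (n : ℚ) - i + 1 := by
    have : (i : ℚ) ≤ n := by exact_mod_cast hi
    linarith
  rcases lt_trichotomy i 0 with h | rfl | h
  · simp [chooseZ, h, show i < 1 by omega]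
  · have : (n : ℚ) + 1 ≠ 0 := by positivity
    simp [chooseZ, this]
  · obtain ⟨a, rfl⟩ : ∃ a : ℕ, i = ((a + 1 : ℕ) : ℤ) := ⟨(i - 1).toNat, by omega⟩
    have h₁ : ((a + 1 : ℕ) : ℤ) - 1 = (a : ℤ) := by push_cast; ring
    have h₂ : ¬ ((a + 1 : ℕ) : ℤ) < 0 := by omega
    have h₃ : ¬ (a : ℤ) < 0 := by omega
    simp only [chooseZ, h₁, if_neg h₂, if_neg h₃, Int.toNat_natCast]
    have key : (n.choose (a + 1) : ℚ) * (a + 1) = n.choose a * ((n : ℚ) - a) := by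
      have := Nat.choose_succ_right_eq n a
      rw [← Nat.cast_sub (show a ≤ n by omega)]
      exact_mod_cast this
    push_cast at hpos ⊢
    rw [div_mul_eq_mul_div, eq_div_iff hpos.ne']
    linear_combination key

theorem walkCount_sub_walkCount_add_two (x : ℕ) (m : ℤ) (hm : 0 ≤ m) :
    ((walkCount (2 * x) (2 * m) - walkCount (2 * x) (2 * m + 2) : ℤ) : ℚ) =
      (2 * (m : ℚ) + 1) / (x + m + 1) * chooseZ (2 * x) (x - m) := by
  have h₁ : 2 * m = ((2 * x : ℕ) : ℤ) - 2 * (x - m) := by push_cast; ring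
  have h₂ : 2 * m + 2 = ((2 * x : ℕ) : ℤ) - 2 * (x - m - 1) := by push_cast; ring
  rw [h₂, h₁, walkCount_eq_chooseZ, walkCount_eq_chooseZ]
  have := chooseZ_sub_chooseZ_pred (2 * x) (x - m) (by omega)
  push_cast at this ⊢
  rw [this]
  congr 2 <;> ring

/-- The contribution of the `k`-th reflections of the endpoint `t` in the two walls
`-1` and `L - 1`. -/
def reflectionTerm (L : ℤ) (j : ℕ) (t : ℤ) (k : ℕ) : ℤ :=
  (walkCount j (t + 2 * k * L) - walkCount j (t + 2 * k * L + 2))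
    - (walkCount j (2 * (k + 1) * L - t - 2) - walkCount j (2 * (k + 1) * L - t - 2 + 2))

theorem reflectionTerm_succ (L : ℤ) (j : ℕ) (t : ℤ) (k : ℕ) :
    reflectionTerm L (j + 1) t k =
      reflectionTerm L j (t - 1) k + reflectionTerm L j (t + 1) k := by
  simp only [reflectionTerm, walkCount]
  ring_nf

theorem sum_reflectionTerm_neg_one {L : ℤ} (hL : 1 < L) {j N : ℕ} (hj : (j : ℤ) ≤ 2 * N * L) :
    ∑ k ∈ range (N + 1), reflectionTerm L j (-1) k = 0 := by
  have h : ∀ k : ℕ, reflectionTerm L j (-1) k =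
      (fun k : ℕ => walkCount j (2 * k * L - 1) - walkCount j (2 * k * L + 1)) k
      - (fun k : ℕ => walkCount j (2 * k * L - 1) - walkCount j (2 * k * L + 1)) (k + 1) := by
    intro k
    simp only [reflectionTerm]
    push_cast
    ring_nf
  rw [sum_congr rfl fun k _ => h k, sum_range_sub']
  have h₁ : (j : ℤ) < 2 * (N + 1 : ℕ) * L - 1 := by push_cast; linarith
  have h₂ : walkCount j (-1) = walkCount j 1 := walkCount_neg j 1
  have h₃ : (j : ℤ) < 2 * (N + 1 : ℕ) * L + 1 := by linarith
  simp only [walkCount_eq_zero h₁, walkCount_eq_zero h₃]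
  simp [h₂]

theorem reflectionTerm_upper_wall (L : ℤ) (j k : ℕ) : reflectionTerm L j (L - 1) k = 0 := by
  simp only [reflectionTerm]
  ring_nf

theorem sum_reflectionTerm_zero {L t : ℤ} (hL : 2 < L) (ht : -1 ≤ t) (ht' : t ≤ L - 1) (N : ℕ) :
    ∑ k ∈ range (N + 1), reflectionTerm L 0 t k = if t = 0 then 1 else 0 := by
  have hz : ∀ s : ℤ, 0 < s → walkCount 0 s = 0 := fun s hs => walkCount_eq_zero (by simpa using hs)
  rw [sum_range_succ', sum_eq_zero]
  · simp only [reflectionTerm]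
    rw [hz (t + _ + 2) (by push_cast; linarith), hz (_ - t - 2) (by push_cast; linarith),
      hz (_ - t - 2 + 2) (by push_cast; linarith)]
    simp [walkCount]
  · intro k _
    have : 0 ≤ (k : ℤ) * L := by positivity
    simp only [reflectionTerm]
    push_cast
    rw [hz _ (by linarith), hz _ (by linarith), hz _ (by linarith), hz _ (by linarith)]
    ring

theorem rL_eq_sum_reflectionTerm {ℓ : ℕ} (hℓ : 1 ≤ ℓ) {N j : ℕ} {t : ℤ}
    (hj : (j : ℤ) ≤ 2 * N * (ℓ + 2)) (ht : -1 ≤ t) (ht' : t ≤ ℓ + 1) :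
    (rL ℓ j t : ℤ) = ∑ k ∈ range (N + 1), reflectionTerm (ℓ + 2) j t k := by
  induction j generalizing t with
  | zero =>
    rw [sum_reflectionTerm_zero (by omega) ht (by omega)]
    simp [rL]
  | succ j ih =>
    rcases ht.eq_or_lt with rfl | h
    · rw [sum_reflectionTerm_neg_one (by omega) hj]
      simp [rL]
    rcases ht'.eq_or_lt with rfl | h'
    · have : (ℓ : ℤ) + 1 = (ℓ + 2) - 1 := by ring
      simp only [this, reflectionTerm_upper_wall]
      simp [rL]
    · have hj' : (j : ℤ) ≤ 2 * N * (ℓ + 2) := by push_cast at hj; linarith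
      simp only [reflectionTerm_succ, sum_add_distrib]
      rw [← ih hj' (by omega) (by omega), ← ih hj' (by omega) (by omega), rL, if_neg (by omega)]
      push_cast
      rfl

/-- Closed form for r_ℓ(j,t), even case j = 2x, t = 2y, with K = ⌈j/(2(ℓ+2))⌉. -/
theorem rL_closed_form_even (ℓ x y : ℕ) (hℓ : 1 ≤ ℓ) (ht : 2 * y ≤ ℓ) :
    (rL ℓ (2 * x) ((2 * y : ℕ) : ℤ) : ℚ) =
      ∑ k ∈ Finset.range ((2 * x + 2 * (ℓ + 2) - 1) / (2 * (ℓ + 2)) + 1),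
        ((2 * (y : ℚ) + 2 * (k : ℚ) * ((ℓ : ℚ) + 2) + 1)
            / ((x : ℚ) + (y : ℚ) + (k : ℚ) * ((ℓ : ℚ) + 2) + 1)
            * (chooseZ (2 * x) ((x : ℤ) - (y : ℤ) - (k : ℤ) * ((ℓ : ℤ) + 2)) : ℚ)
          - ((2 * (k : ℚ) + 2) * ((ℓ : ℚ) + 2) - 2 * (y : ℚ) - 1)
            / ((x : ℚ) + ((k : ℚ) + 1) * ((ℓ : ℚ) + 2) - (y : ℚ))
            * (chooseZ (2 * x)
                ((x : ℤ) - ((k : ℤ) + 1) * ((ℓ : ℤ) + 2) + (y : ℤ) + 1) : ℚ)) := by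
  set K := (2 * x + 2 * (ℓ + 2) - 1) / (2 * (ℓ + 2)) with hK
  have hx : ((2 * x : ℕ) : ℤ) ≤ 2 * K * (ℓ + 2) := by
    have := Nat.lt_div_mul_add (a := 2 * x + 2 * (ℓ + 2) - 1) (b := 2 * (ℓ + 2)) (by omega)
    rw [← hK] at this
    have h : 2 * x ≤ K * (2 * (ℓ + 2)) := by omega
    have h' : ((2 * x : ℕ) : ℤ) ≤ ((K * (2 * (ℓ + 2)) : ℕ) : ℤ) := by exact_mod_cast h
    push_cast at h' ⊢
    linarith
  have hr := rL_eq_sum_reflectionTerm hℓ (t := ((2 * y : ℕ) : ℤ)) hx (by omega) (by omega)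
  rw [← Int.cast_natCast (rL ℓ (2 * x) ((2 * y : ℕ) : ℤ)), hr, Int.cast_sum]
  refine sum_congr rfl fun k _ => ?_
  have hk : 0 ≤ (k : ℤ) * (ℓ + 2) := by positivity
  have hy : 2 * (y : ℤ) ≤ ℓ := by exact_mod_cast ht
  have h₁ := walkCount_sub_walkCount_add_two x (y + k * (ℓ + 2)) (by positivity)
  have h₂ := walkCount_sub_walkCount_add_two x ((k + 1) * (ℓ + 2) - y - 1) (by linarith)
  have e₁ : ((2 * y : ℕ) : ℤ) + 2 * k * (ℓ + 2) = 2 * (y + k * (ℓ + 2)) := by push_cast; ring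
  have e₂ : 2 * ((k : ℤ) + 1) * (ℓ + 2) - ((2 * y : ℕ) : ℤ) - 2 =
      2 * ((k + 1) * (ℓ + 2) - y - 1) := by push_cast; ring
  rw [reflectionTerm, e₁, e₂, Int.cast_sub, h₁, h₂]
  have e₃ : (x : ℤ) - (y + k * (ℓ + 2)) = x - y - k * (ℓ + 2) := by ring
  have e₄ : (x : ℤ) - ((k + 1) * (ℓ + 2) - y - 1) = x - (k + 1) * (ℓ + 2) + y + 1 := by ring
  rw [e₃, e₄]
  push_cast
  congr 3 <;> ring
end

section
/- Vanishing intersection numbers: let ℓ ≥ 1, let n ≥ 4 be even, and let 1 ≤ i ≤ n−3. If i < ℓ, or if i ≢ ℓ (mod 2), then I_ℓ(n−i−2, i, 1, 1) = 0. -/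
open Finset

/-- Fusion with the weight `1` moves a weight up or down by one. -/
lemma N₃_one (ℓ a α : ℕ) (ha : a ≤ ℓ) (hα : α ≤ ℓ) :
    N₃ ℓ a 1 α = if α = a + 1 ∨ α + 1 = a then 1 else 0 := by
  unfold N₃
  split_ifs <;> omega

lemma sum_mul_N₃_one (ℓ a : ℕ) (ha : a ≤ ℓ) (f : ℕ → ℚ) :
    ∑ α ∈ Finset.range (ℓ + 1), f α * (N₃ ℓ a 1 α : ℚ) =
      (if a + 1 ≤ ℓ then f (a + 1) else 0) + if 1 ≤ a then f (a - 1) else 0 := by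
  have key : ∀ α ∈ Finset.range (ℓ + 1), f α * (N₃ ℓ a 1 α : ℚ) =
      (if α = a + 1 then f α else 0) + if α = a - 1 then (if 1 ≤ a then f α else 0) else 0 := by
    intro α hα
    rw [N₃_one ℓ a α ha (by simpa [Nat.lt_succ_iff] using hα)]
    split_ifs <;> first | omega | simp
  rw [Finset.sum_congr rfl key, Finset.sum_add_distrib, Finset.sum_ite_eq', Finset.sum_ite_eq']
  have h1 : a - 1 < ℓ + 1 := by omega
  simp [h1]

lemma cast_N_one_one (ℓ a b : ℕ) :
    (N ℓ [a, b, 1, 1] : ℚ) =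
      ∑ α ∈ Finset.range (ℓ + 1), (N₃ ℓ a b α : ℚ) * (N₃ ℓ 1 1 α : ℚ) := by
  simp [N, Nrev]

/-- For weights `(a, b, 1, 1)` the degree vanishes away from `a = b = ℓ`. -/
lemma degF_one_one_eq_zero (ℓ a b : ℕ) (hℓ : 1 ≤ ℓ) (ha : a ≤ ℓ) (hb : b ≤ ℓ)
    (hab : ¬(a = ℓ ∧ b = ℓ)) : degF ℓ a b 1 1 = 0 := by
  have hsum : ∑ α ∈ Finset.range (ℓ + 1), cas α *
      ((N₃ ℓ a b α * N₃ ℓ 1 1 α + N₃ ℓ a 1 α * N₃ ℓ b 1 α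
        + N₃ ℓ a 1 α * N₃ ℓ b 1 α : ℕ) : ℚ) =
      ∑ α ∈ Finset.range (ℓ + 1), (cas α * N₃ ℓ a b α) * (N₃ ℓ 1 1 α : ℚ) +
      ∑ α ∈ Finset.range (ℓ + 1), (2 * cas α * N₃ ℓ b 1 α) * (N₃ ℓ a 1 α : ℚ) := by
    rw [← Finset.sum_add_distrib]
    refine Finset.sum_congr rfl fun α _ => ?_
    push_cast
    ring
  unfold degF
  rw [hsum, cast_N_one_one, sum_mul_N₃_one ℓ 1 hℓ, sum_mul_N₃_one ℓ 1 hℓ,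
    sum_mul_N₃_one ℓ a ha]
  refine mul_eq_zero_of_right _ ?_
  have e0 : N₃ ℓ a b 0 = if a = b then 1 else 0 := by
    unfold N₃
    split_ifs <;> omega
  have e2 : N₃ ℓ a b 2 =
      if (a = b ∧ 1 ≤ a) ∨ b = a + 2 ∨ a = b + 2 then 1 else 0 := by
    unfold N₃
    split_ifs <;> omega
  have eu : a + 1 ≤ ℓ → N₃ ℓ b 1 (a + 1) = if b = a ∨ b = a + 2 then 1 else 0 := by
    intro h
    rw [N₃_one ℓ b _ hb h]
    split_ifs <;> omega
  have ed : 1 ≤ a → N₃ ℓ b 1 (a - 1) = if b = a ∨ a = b + 2 then 1 else 0 := by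
    intro h
    rw [N₃_one ℓ b _ hb (by omega)]
    split_ifs <;> omega
  simp only [le_refl, if_true, Nat.reduceAdd, Nat.sub_self, e0, e2]
  by_cases h1 : a = b
  · subst h1
    have h2 : a + 1 ≤ ℓ := by omega
    rcases Nat.eq_zero_or_pos a with rfl | h3
    · simp [eu h2, hℓ, cas]
      norm_num
    · have h4 : 2 ≤ ℓ := by omega
      have h5 : 1 ≤ a := h3
      simp [eu h2, ed h3, h2, h4, h5, cas]
      ring
  · by_cases h2 : b = a + 2
    · subst h2
      have h3 : a + 1 ≤ ℓ := by omega
      have h4 : 2 ≤ ℓ := by omega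
      have h6 : a ≠ a + 2 + 2 := by omega
      by_cases h5 : 1 ≤ a
      · simp [eu h3, ed h5, h3, h4, h5, h6, cas]
        ring
      · simp [eu h3, h3, h4, h5, h6, cas]
        ring
    · by_cases h3 : a = b + 2
      · subst h3
        have h4 : 2 ≤ ℓ := by omega
        have h5 : 1 ≤ b + 2 := by omega
        have h7 : b ≠ b + 2 + 2 := by omega
        have ed' : N₃ ℓ b 1 (b + 1) = 1 := by simpa using ed h5
        by_cases h6 : b + 2 + 1 ≤ ℓ
        · simp [eu h6, ed', h4, h6, h7, cas]
          ring
        · simp [ed', h4, h6, cas]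
          ring
      · have h1' : b ≠ a := fun h => h1 h.symm
        split_ifs with h4 h5 h6 h5 h6 h5 <;> simp_all

lemma rL_eq_zero_of_lt (ℓ : ℕ) : ∀ (j : ℕ) (t : ℤ), (j : ℤ) < t → rL ℓ j t = 0
  | 0, t, h => by
    have : t ≠ 0 := by push_cast at h; omega
    simp [rL, this]
  | j + 1, t, h => by
    push_cast at h
    simp [rL, rL_eq_zero_of_lt ℓ j (t - 1) (by omega), rL_eq_zero_of_lt ℓ j (t + 1) (by omega)]

lemma rL_eq_zero_of_parity (ℓ : ℕ) :
    ∀ (j : ℕ) (t : ℤ), (j : ℤ) % 2 ≠ t % 2 → rL ℓ j t = 0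
  | 0, t, h => by
    have : t ≠ 0 := by rintro rfl; simp at h
    simp [rL, this]
  | j + 1, t, h => by
    push_cast at h
    simp [rL, rL_eq_zero_of_parity ℓ j (t - 1) (by omega),
      rL_eq_zero_of_parity ℓ j (t + 1) (by omega)]

lemma rL_one_eq_zero (ℓ : ℕ) (t : ℤ) (ht : t ≠ 1) (ht' : 0 ≤ t) : rL ℓ 1 t = 0 := by
  have h1 : t - 1 ≠ 0 := by omega
  have h2 : t + 1 ≠ 0 := by omega
  simp [rL, h1, h2]

/-- Vanishing intersection numbers: if i < ℓ or i ≢ ℓ (mod 2), then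
I_ℓ(n−i−2,i,1,1) = 0. -/
theorem vanishing_intersection (ℓ n i : ℕ) (hℓ : 1 ≤ ℓ) (hn : 4 ≤ n) (hev : Even n)
    (hi1 : 1 ≤ i) (hi2 : i ≤ n - 3) (h : i < ℓ ∨ i % 2 ≠ ℓ % 2) :
    IF ℓ (n - i - 2) i 1 1 = 0 := by
  have hr : rL ℓ i (ℓ : ℤ) = 0 := by
    rcases h with h | h
    · exact rL_eq_zero_of_lt ℓ i ℓ (by exact_mod_cast h)
    · exact rL_eq_zero_of_parity ℓ i ℓ (by exact_mod_cast h)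
  unfold IF
  refine Finset.sum_eq_zero fun a ha => Finset.sum_eq_zero fun b hb =>
    Finset.sum_eq_zero fun c _ => Finset.sum_eq_zero fun d _ => ?_
  rw [Finset.mem_range] at ha hb
  by_cases hc : c = 1
  · by_cases hd : d = 1
    · subst hc hd
      by_cases hab : a = ℓ ∧ b = ℓ
      · simp [hab.2, hr]
      · simp [degF_one_one_eq_zero ℓ a b hℓ (by omega) (by omega) hab]
    · simp [rL_one_eq_zero ℓ d (by exact_mod_cast hd) (by positivity)]
  · simp [rL_one_eq_zero ℓ c (by exact_mod_cast hc) (by positivity)]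
end

section
/- Level-1 intersection numbers: let a, b, c, d ≥ 1 be integers with a+b+c+d even. Then I_1(a,b,c,d) = 1 if the product abcd is odd, and I_1(a,b,c,d) = 0 if abcd is even. -/
open Finset

/-- At level one, `rL` detects the parity of its first argument. -/
theorem rL_one (j : ℕ) :
    rL 1 j 0 = (if j % 2 = 0 then 1 else 0) ∧ rL 1 j 1 = (if j % 2 = 0 then 0 else 1) := by
  have rL_neg (j : ℕ) : rL 1 j (-1) = 0 := by cases j <;> simp [rL]
  have rL_two (j : ℕ) : rL 1 j 2 = 0 := by cases j <;> simp [rL]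
  induction j with
  | zero => simp [rL]
  | succ j ih =>
    obtain ⟨h₀, h₁⟩ := ih
    constructor
    · simp [rL, rL_neg, h₁]
      grind
    · simp [rL, rL_two, h₀]
      grind

/-- The four-point degree at level one is nonzero only when all weights are one. -/
theorem degF_one (p q r s : ℕ) (hp : p < 2) (hq : q < 2) (hr : r < 2) (hs : s < 2) :
    degF 1 p q r s = if p = 1 ∧ q = 1 ∧ r = 1 ∧ s = 1 then 1 else 0 := by
  interval_cases p <;> interval_cases q <;> interval_cases r <;> interval_cases s <;>
    norm_num [degF, N, Nrev, N₃, cas, Finset.sum_range_succ]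

/-- At level one, the intersection number is the product of the parities of the indices. -/
theorem IF_one (a b c d : ℕ) : IF 1 a b c d = rL 1 a 1 * rL 1 b 1 * rL 1 c 1 * rL 1 d 1 := by
  simp [IF, Finset.sum_range_succ, degF_one]

/-- Level-1 intersection numbers. -/
theorem level_one_intersection (a b c d : ℕ) (ha : 1 ≤ a) (hb : 1 ≤ b) (hc : 1 ≤ c)
    (hd : 1 ≤ d) (hev : Even (a + b + c + d)) :
    (Odd (a * b * c * d) → IF 1 a b c d = 1) ∧
    (Even (a * b * c * d) → IF 1 a b c d = 0) := by
  simp only [IF_one, (rL_one _).2, Nat.odd_iff, Nat.even_iff]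
  rcases Nat.mod_two_eq_zero_or_one a with h₁ | h₁ <;>
    rcases Nat.mod_two_eq_zero_or_one b with h₂ | h₂ <;>
    rcases Nat.mod_two_eq_zero_or_one c with h₃ | h₃ <;>
    rcases Nat.mod_two_eq_zero_or_one d with h₄ | h₄ <;>
    simp [Nat.mul_mod, h₁, h₂, h₃, h₄]
end

section
/- Nonvanishing criterion for sl₂ ranks: let ℓ ≥ 1, let λ₁,…,λₙ be weights in {0,…,ℓ}, and set Λ = λ₁ + ⋯ + λₙ. Then N(λ₁,…,λₙ) ≠ 0 if and only if Λ is even and, for every subset I ⊆ {1,…,n} such that n − |I| is odd, the inequality Λ − (n − |I| − 1)·ℓ ≤ 2·Σ_{i∈I} λᵢ holds. -/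
open Finset

/-- Truncated minimal costs of a list of weights. Choosing a subset of the entries costs `ℓ - a`
for each chosen entry `a` and `a` for each other one; the first component is the minimal cost over
subsets of even cardinality, the second over subsets of odd cardinality, up to terms which
are at least `ℓ`. -/
def minCost (ℓ : ℕ) : List ℕ → ℤ × ℤ
  | [] => (0, ℓ)
  | a :: l =>
      (min ((minCost ℓ l).1 + a) ((minCost ℓ l).2 + (ℓ - a)),
        min ((minCost ℓ l).2 + a) ((minCost ℓ l).1 + (ℓ - a)))

theorem minCost_perm (ℓ : ℕ) {l₁ l₂ : List ℕ} (h : l₁.Perm l₂) :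
    minCost ℓ l₁ = minCost ℓ l₂ := by
  induction h with
  | nil => rfl
  | cons a _ ih => simp only [minCost, ih]
  | swap a b l =>
    ext <;> refine eq_of_forall_le_iff fun z => ?_ <;>
      simp only [minCost, le_min_iff, ← sub_le_iff_le_add] <;> omega
  | trans _ _ ih₁ ih₂ => exact ih₁.trans ih₂

theorem minCost_parity (ℓ : ℕ) (l : List ℕ) :
    (minCost ℓ l).1 % 2 = (l.sum : ℤ) % 2 ∧ (minCost ℓ l).2 % 2 = ((l.sum : ℤ) + ℓ) % 2 := by
  induction l with
  | nil => simp [minCost]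
  | cons a l ih =>
    simp only [minCost, List.sum_cons, Nat.cast_add]
    omega

theorem le_minCost_add (ℓ : ℕ) (l : List ℕ) (hl : ∀ a ∈ l, a ≤ ℓ) :
    0 ≤ (minCost ℓ l).1 ∧ 0 ≤ (minCost ℓ l).2 ∧ (ℓ : ℤ) ≤ (minCost ℓ l).1 + (minCost ℓ l).2 := by
  induction l with
  | nil => simp [minCost]
  | cons a l ih =>
    rw [List.forall_mem_cons] at hl
    have := ih hl.2
    have := hl.1
    simp only [minCost]
    omega

theorem N₃_ne_zero_iff (ℓ a b c : ℕ) :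
    N₃ ℓ a b c ≠ 0 ↔
      (a + b + c) % 2 = 0 ∧ a + b + c ≤ 2 * ℓ ∧ a ≤ b + c ∧ b ≤ a + c ∧ c ≤ a + b := by
  unfold N₃
  split_ifs <;> simp <;> omega

theorem Nrev_ne_zero_iff (ℓ : ℕ) : ∀ l : List ℕ, (∀ a ∈ l, a ≤ ℓ) →
    (Nrev ℓ l ≠ 0 ↔ l.sum % 2 = 0 ∧ (ℓ : ℤ) ≤ (minCost ℓ l).2)
  | [], _ => by simp [Nrev, minCost]
  | [a], h => by
    simp only [List.forall_mem_cons] at h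
    simp only [Nrev, minCost, List.sum_cons, List.sum_nil, le_min_iff, ← sub_le_iff_le_add]
    split_ifs <;> omega
  | [a, b], h => by
    simp only [List.forall_mem_cons] at h
    simp only [Nrev, minCost, List.sum_cons, List.sum_nil, le_min_iff, ← sub_le_iff_le_add]
    split_ifs <;> omega
  | [a, b, c], h => by
    simp only [List.forall_mem_cons] at h
    rw [Nrev, N₃_ne_zero_iff]
    simp only [minCost, List.sum_cons, List.sum_nil, le_min_iff, ← sub_le_iff_le_add]
    omega
  | a :: b :: c :: d :: rest, h => by
    have ih (μ : ℕ) (hμ : μ ≤ ℓ) := Nrev_ne_zero_iff ℓ (μ :: c :: d :: rest) (by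
      simp only [List.forall_mem_cons] at h ⊢
      exact ⟨hμ, h.2.2⟩)
    rw [List.forall_mem_cons, List.forall_mem_cons] at h
    rw [Nrev]
    generalize c :: d :: rest = l at *
    have key : ∑ μ ∈ range (ℓ + 1), Nrev ℓ (μ :: l) * N₃ ℓ b a μ ≠ 0 ↔
        ∃ μ ≤ ℓ, Nrev ℓ (μ :: l) ≠ 0 ∧ N₃ ℓ b a μ ≠ 0 := by
      simp [Finset.sum_eq_zero_iff]
    have hpar := minCost_parity ℓ l
    have hadd := le_minCost_add ℓ l h.2.2
    obtain ⟨ha, hb, -⟩ := h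
    rw [key]
    constructor
    · rintro ⟨μ, hμ, h₁, h₂⟩
      rw [ih μ hμ] at h₁
      rw [N₃_ne_zero_iff] at h₂
      simp only [minCost, List.sum_cons, le_min_iff, ← sub_le_iff_le_add] at h₁ ⊢
      omega
    · intro h₁
      simp only [minCost, List.sum_cons, le_min_iff, ← sub_le_iff_le_add] at h₁
      obtain ⟨μ, hμ⟩ : ∃ μ : ℕ,
          (μ : ℤ) = max (max ((a : ℤ) - b) (b - a)) (ℓ - (minCost ℓ l).2) :=
        ⟨(max (max ((a : ℤ) - b) (b - a)) (ℓ - (minCost ℓ l).2)).toNat, by omega⟩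
      have hle : μ ≤ ℓ := by omega
      refine ⟨μ, hle, (ih μ hle).2 ?_, ?_⟩
      · simp only [minCost, List.sum_cons, le_min_iff, ← sub_le_iff_le_add]
        omega
      · rw [N₃_ne_zero_iff]
        omega
  termination_by l => l.length

theorem le_minCost_iff {ι : Type*} [DecidableEq ι] (ℓ : ℕ) (lam : ι → ℕ) (s : Finset ι)
    (h : ∀ i ∈ s, lam i ≤ ℓ) (z : ℤ) (hz : z ≤ ℓ) :
    (z ≤ (minCost ℓ (s.toList.map lam)).1 ↔ ∀ I ⊆ s, (s.card - I.card) % 2 = 0 →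
      z ≤ ((s.card : ℤ) - I.card) * ℓ - ∑ i ∈ s, (lam i : ℤ) + 2 * ∑ i ∈ I, (lam i : ℤ)) ∧
    (z ≤ (minCost ℓ (s.toList.map lam)).2 ↔ ∀ I ⊆ s, (s.card - I.card) % 2 = 1 →
      z ≤ ((s.card : ℤ) - I.card) * ℓ - ∑ i ∈ s, (lam i : ℤ) + 2 * ∑ i ∈ I, (lam i : ℤ)) := by
  induction s using Finset.induction_on generalizing z with
  | empty => simp [minCost, Finset.subset_empty, hz]
  | insert a s ha ih =>
    rw [Finset.forall_mem_insert] at h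
    have hsplit (P : Finset ι → Prop) :
        (∀ I ⊆ insert a s, P I) ↔ (∀ I ⊆ s, P I) ∧ ∀ I ⊆ s, P (insert a I) := by
      simp only [← Finset.mem_powerset, Finset.powerset_insert, Finset.mem_union,
        Finset.mem_image, or_imp, forall_and, forall_exists_index, and_imp, forall_apply_eq_imp_iff₂]
    have ih₁ := ih h.2 (z - lam a) (by omega)
    have ih₂ := ih h.2 (z - (ℓ - lam a)) (by have := h.1; omega)
    have hmin : minCost ℓ ((insert a s).toList.map lam) =
        minCost ℓ (lam a :: s.toList.map lam) :=
      minCost_perm ℓ ((Finset.toList_insert ha).map lam)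
    rw [hmin, hsplit, hsplit]
    simp only [minCost, le_min_iff, ← sub_le_iff_le_add]
    rw [ih₁.1, ih₁.2, ih₂.1, ih₂.2, Finset.card_insert_of_notMem ha, Finset.sum_insert ha]
    constructor <;> rw [and_comm] <;> refine and_congr ?_ ?_ <;>
      refine forall₂_congr fun I hI => ?_
    all_goals
      have hc := Finset.card_le_card hI
      have haI : a ∉ I := fun h => ha (hI h)
      try rw [Finset.card_insert_of_notMem haI, Finset.sum_insert haI]
      refine imp_congr (by omega) ?_
      push_cast
      constructor <;> intro <;> linarith

/-- Nonvanishing criterion for sl₂ ranks. -/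
theorem rank_nonzero_iff (ℓ n : ℕ) (hℓ : 1 ≤ ℓ) (lam : Fin n → ℕ)
    (hlam : ∀ i, lam i ≤ ℓ) :
    N ℓ (List.ofFn lam) ≠ 0 ↔
      (Even (∑ i, lam i) ∧
        ∀ I : Finset (Fin n), Odd (n - I.card) →
          ((∑ i, lam i : ℕ) : ℤ) - ((n : ℤ) - (I.card : ℤ) - 1) * (ℓ : ℤ)
            ≤ 2 * ∑ i ∈ I, (lam i : ℤ)) := by
  have hperm : (List.ofFn lam).reverse.Perm (univ.toList.map lam) := by
    refine (List.reverse_perm _).trans ?_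
    rw [← Multiset.coe_eq_coe, ← Multiset.map_coe, Finset.coe_toList, Fin.univ_val_map]
  rw [N, Nrev_ne_zero_iff ℓ _ (by simpa using hlam), minCost_perm ℓ hperm,
    (le_minCost_iff ℓ lam univ (fun i _ => hlam i) ℓ le_rfl).2, List.sum_reverse, List.sum_ofFn,
    Nat.even_iff]
  refine and_congr_right fun _ => forall_congr' fun I => ?_
  rw [Finset.card_univ, Fintype.card_fin, Nat.odd_iff]
  simp only [Finset.subset_univ, true_imp_iff]
  refine imp_congr_right fun _ => ?_
  push_cast
  constructor <;> intro <;> linarith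
end
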